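/- arXiv:1010.4642 — 2 statements merged into one kernel-verified Lean document; each statement's English description precedes it below -/
import Mathlib

section
/- Let ‖·‖ be the Euclidean norm on ℝ^d, p = 2, and Γ = {x_1,…,x_k} ⊂ ℝ^d a grid of affine dimension d. If I ⊂ {1,…,k} with |I| = d+1 indexes an affinely independent family {x_j : j ∈ I} whose circumscribed sphere contains no point of Γ in its interior (the Delaunay property), then for every ξ ∈ conv{x_j : j ∈ I} the barycentric coordinates λ_I of ξ with respect to (x_j)_{j∈I} achieve the infimum defining F^2(ξ;Γ), i.e. F^2(ξ;Γ) = Σ_{j∈I} λ_j ‖ξ − x_j‖^2; in particular the optimality region D_I(Γ) equals conv{x_j : j ∈ I}. -/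
open MeasureTheory Set
open scoped ENNReal

/-- `p`-th power of the local dual quantization error `F_p(ξ; Γ)^p` for the grid given by the
tuple `x = (x_1, …, x_k)`, with the convention `inf ∅ = +∞`. -/
noncomputable def dualQuantFp {E : Type*} [NormedAddCommGroup E] [NormedSpace ℝ E]
    (p : ℝ) {k : ℕ} (x : Fin k → E) (ξ : E) : ℝ≥0∞ :=
  ⨅ l : {l : Fin k → ℝ // (∀ i, 0 ≤ l i) ∧ ∑ i, l i = 1 ∧ ∑ i, l i • x i = ξ},
    ENNReal.ofReal (∑ i, l.1 i * ‖ξ - x i‖ ^ p)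

/-- Optimality region `D_I(Γ)`: the set of points `ξ` whose barycentric coordinates w.r.t.
`(x_j)_{j∈I}` are nonnegative and achieve `F^p(ξ;Γ)`. -/
def dualQuantD {E : Type*} [NormedAddCommGroup E] [NormedSpace ℝ E]
    (p : ℝ) {k : ℕ} (x : Fin k → E) (I : Finset (Fin k)) : Set E :=
  {ξ | ∃ w : Fin k → ℝ, (∀ i, 0 ≤ w i) ∧ (∀ i ∉ I, w i = 0) ∧
    ∑ i, w i = 1 ∧ ∑ i, w i • x i = ξ ∧
    ENNReal.ofReal (∑ i, w i * ‖ξ - x i‖ ^ p) = dualQuantFp p x ξ}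

/-- Huygens' identity: the second moment about `z` of a weighted family with barycenter `ξ` is its
second moment about `ξ` plus `‖z - ξ‖ ^ 2`. -/
theorem sum_mul_norm_sub_sq_eq {E ι : Type*} [NormedAddCommGroup E] [InnerProductSpace ℝ E]
    [Fintype ι] {x : ι → E} {w : ι → ℝ} {ξ : E} (hsum : ∑ i, w i = 1)
    (hbary : ∑ i, w i • x i = ξ) (z : E) :
    ∑ i, w i * ‖z - x i‖ ^ 2 = ∑ i, w i * ‖ξ - x i‖ ^ 2 + ‖z - ξ‖ ^ 2 := by
  have hcross : ∑ i, w i * inner ℝ (z - ξ) (ξ - x i) = 0 := by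
    simp_rw [← real_inner_smul_right, ← inner_sum, smul_sub, Finset.sum_sub_distrib,
      ← Finset.sum_smul, hsum, hbary, one_smul, sub_self, inner_zero_right]
  have hexpand (i : ι) : w i * ‖z - x i‖ ^ 2 =
      w i * ‖ξ - x i‖ ^ 2 + w i * ‖z - ξ‖ ^ 2 + 2 * (w i * inner ℝ (z - ξ) (ξ - x i)) := by
    rw [← sub_add_sub_cancel z ξ (x i), norm_add_sq_real]
    ring
  simp_rw [hexpand, Finset.sum_add_distrib, ← Finset.mul_sum, hcross, ← Finset.sum_mul, hsum]
  ring

/-- The convex hull of the points indexed by `I` consists of the barycenters of nonnegative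
weights supported on `I`. -/
theorem mem_convexHull_image_iff_exists_weights {E ι : Type*} [AddCommGroup E] [Module ℝ E]
    [Fintype ι] {x : ι → E} {I : Finset ι} {ξ : E} :
    ξ ∈ convexHull ℝ (x '' ↑I) ↔
      ∃ w : ι → ℝ, (∀ i, 0 ≤ w i) ∧ (∀ i ∉ I, w i = 0) ∧ ∑ i, w i = 1 ∧
        ∑ i, w i • x i = ξ := by
  classical
  constructor
  · intro hξ
    refine convexHull_min (t := {ξ | ∃ w : ι → ℝ, (∀ i, 0 ≤ w i) ∧ (∀ i ∉ I, w i = 0) ∧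
      ∑ i, w i = 1 ∧ ∑ i, w i • x i = ξ}) ?_ ?_ hξ
    · rintro _ ⟨j, hj, rfl⟩
      refine ⟨Pi.single j 1, fun i => ?_, fun i hi => ?_, by simp, by simp [Pi.single_apply]⟩
      · by_cases h : i = j <;> simp [h]
      · have h : i ≠ j := by
          rintro rfl
          exact hi hj
        exact Pi.single_eq_of_ne h 1
    · rintro _ ⟨u, hu, huI, husum, rfl⟩ _ ⟨v, hv, hvI, hvsum, rfl⟩ a b ha hb hab
      refine ⟨fun i => a * u i + b * v i, fun i => ?_, fun i hi => by simp [huI i hi, hvI i hi],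
        ?_, ?_⟩
      · have := hu i
        have := hv i
        positivity
      · rw [Finset.sum_add_distrib, ← Finset.mul_sum, ← Finset.mul_sum, husum, hvsum]
        simpa using hab
      · simp only [add_smul, mul_smul, Finset.sum_add_distrib, Finset.smul_sum]
  · rintro ⟨w, hw, hwI, hsum, rfl⟩
    rw [← Finset.sum_subset I.subset_univ (fun i _ hi => by rw [hwI i hi, zero_smul])]
    rw [← Finset.sum_subset I.subset_univ (fun i _ hi => hwI i hi)] at hsum
    exact (convex_convexHull ℝ _).sum_mem (fun i _ => hw i) hsum
      fun i hi => subset_convexHull ℝ _ (mem_image_of_mem x hi)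

/-- If some sphere passes through the points indexed by `I` and has no point of the grid inside,
weights supported on `I` minimize the quadratic local dual quantization error. -/
theorem dualQuantFp_two_eq_of_delaunay {E : Type*} [NormedAddCommGroup E] [InnerProductSpace ℝ E]
    {k : ℕ} {x : Fin k → E} {I : Finset (Fin k)} {z : E} {r : ℝ} (hr : 0 ≤ r)
    (hsphere : ∀ j ∈ I, dist z (x j) = r) (hdelaunay : ∀ i, r ≤ dist z (x i))
    {ξ : E} {w : Fin k → ℝ} (hw : ∀ i, 0 ≤ w i) (hwI : ∀ i ∉ I, w i = 0)
    (hsum : ∑ i, w i = 1) (hbary : ∑ i, w i • x i = ξ) :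
    dualQuantFp 2 x ξ = ENNReal.ofReal (∑ i, w i * ‖ξ - x i‖ ^ (2 : ℝ)) := by
  refine le_antisymm (iInf_le_of_le ⟨w, hw, hsum, hbary⟩ le_rfl) (le_iInf ?_)
  rintro ⟨l, hl, hlsum, hlbary⟩
  refine ENNReal.ofReal_le_ofReal ?_
  simp only [Real.rpow_two]
  have hwz : ∑ i, w i * ‖z - x i‖ ^ 2 = r ^ 2 := by
    rw [← one_mul (r ^ 2), ← hsum, Finset.sum_mul]
    refine Finset.sum_congr rfl fun i _ => ?_
    by_cases hi : i ∈ I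
    · rw [← dist_eq_norm, hsphere i hi]
    · simp [hwI i hi]
  have hlz : r ^ 2 ≤ ∑ i, l i * ‖z - x i‖ ^ 2 := by
    rw [← one_mul (r ^ 2), ← hlsum, Finset.sum_mul]
    refine Finset.sum_le_sum fun i _ => mul_le_mul_of_nonneg_left ?_ (hl i)
    rw [← dist_eq_norm]
    exact pow_le_pow_left₀ hr (hdelaunay i) 2
  linarith [sum_mul_norm_sub_sq_eq hsum hbary z, sum_mul_norm_sub_sq_eq hlsum hlbary z]

/-- Euclidean quadratic case: if `I` indexes `d+1` affinely independent points
of the grid `Γ = {x_1,…,x_k} ⊂ ℝ^d` (of affine dimension `d`) whose circumscribed sphere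
contains no point of `Γ` in its interior (Delaunay property), then for every
`ξ ∈ conv{x_j : j ∈ I}` its barycentric coordinates w.r.t. `(x_j)_{j∈I}` achieve `F²(ξ;Γ)`,
and `D_I(Γ) = conv{x_j : j ∈ I}`. -/
theorem stmt12 (d k : ℕ) (x : Fin k → EuclideanSpace ℝ (Fin d))
    (hspan : affineSpan ℝ (Set.range x) = ⊤)
    (I : Finset (Fin k)) (hcard : I.card = d + 1)
    (hindep : AffineIndependent ℝ (fun j : I => x j))
    (z : EuclideanSpace ℝ (Fin d)) (r : ℝ)
    (hsphere : ∀ j ∈ I, dist z (x j) = r)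
    (hdelaunay : ∀ i, r ≤ dist z (x i)) :
    (∀ ξ ∈ convexHull ℝ (x '' ↑I), ∀ w : Fin k → ℝ,
      (∀ i ∉ I, w i = 0) → (∀ i, 0 ≤ w i) → ∑ i, w i = 1 → ∑ i, w i • x i = ξ →
      dualQuantFp 2 x ξ = ENNReal.ofReal (∑ i, w i * ‖ξ - x i‖ ^ (2 : ℝ))) ∧
    dualQuantD 2 x I = convexHull ℝ (x '' ↑I) := by
  obtain ⟨j, hj⟩ : I.Nonempty := Finset.card_pos.mp (by omega)
  have hr : 0 ≤ r := hsphere j hj ▸ dist_nonneg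
  refine ⟨fun ξ _ w hwI hw hsum hbary =>
    dualQuantFp_two_eq_of_delaunay hr hsphere hdelaunay hw hwI hsum hbary, ?_⟩
  ext ξ
  rw [mem_convexHull_image_iff_exists_weights]
  constructor
  · rintro ⟨w, hw, hwI, hsum, hbary, -⟩
    exact ⟨w, hw, hwI, hsum, hbary⟩
  · rintro ⟨w, hw, hwI, hsum, hbary⟩
    exact ⟨w, hw, hwI, hsum, hbary,
      (dualQuantFp_two_eq_of_delaunay hr hsphere hdelaunay hw hwI hsum hbary).symm⟩
end

section
/- Let ‖·‖ be the Euclidean norm on ℝ^d, p = 2, and Γ = {x_1,…,x_k} ⊂ ℝ^d a grid of affine dimension d. If I ⊂ {1,…,k} with |I| = d+1 indexes an affinely independent family {x_j : j ∈ I} whose optimality region D_I(Γ) has nonempty interior, then the d-simplex defined by {x_j : j ∈ I} has the Delaunay property for Γ, i.e. its circumscribed sphere contains no point of Γ in its interior. -/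
open MeasureTheory Set
open scoped ENNReal

/-- Huygens' formula: the inertia of a weighted family about its barycentre `ξ`, in terms of its
inertia about an arbitrary point `z`. -/
theorem sum_mul_sq_norm_sub_barycenter {ι E : Type*} [NormedAddCommGroup E]
    [InnerProductSpace ℝ E] (s : Finset ι) {l : ι → ℝ} {x : ι → E} {ξ : E}
    (hl : ∑ i ∈ s, l i = 1) (hx : ∑ i ∈ s, l i • x i = ξ) (z : E) :
    ∑ i ∈ s, l i * ‖ξ - x i‖ ^ 2 = ∑ i ∈ s, l i * ‖z - x i‖ ^ 2 - ‖z - ξ‖ ^ 2 := by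
  have hzero : ∑ i ∈ s, l i • (ξ - x i) = 0 := by
    simp only [smul_sub, Finset.sum_sub_distrib, ← Finset.sum_smul, hl, hx, one_smul, sub_self]
  have hinner : ∑ i ∈ s, l i * inner ℝ (z - ξ) (ξ - x i) = 0 := by
    simp only [← real_inner_smul_right, ← inner_sum, hzero, inner_zero_right]
  have hsq (i : ι) : l i * ‖z - x i‖ ^ 2 =
      l i * ‖z - ξ‖ ^ 2 + 2 * (l i * inner ℝ (z - ξ) (ξ - x i)) + l i * ‖ξ - x i‖ ^ 2 := by
    rw [← sub_add_sub_cancel z ξ (x i), norm_add_sq_real]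
    ring
  simp only [hsq, Finset.sum_add_distrib, ← Finset.sum_mul, ← Finset.mul_sum, hl, hinner]
  ring

/-- Barycentric coordinates with respect to a subfamily, extended by zero to the whole family. -/
theorem AffineBasis.exists_coord_extend {ι E : Type*} [Fintype ι] [DecidableEq ι]
    [NormedAddCommGroup E] [NormedSpace ℝ E] {I : Finset ι} {x : ι → E}
    (B : AffineBasis I ℝ E) (hB : ∀ j, B j = x j) (y : E) :
    ∃ c : ι → ℝ, (∀ i ∉ I, c i = 0) ∧ (∀ j : I, c j = B.coord j y) ∧
      ∑ i, c i = 1 ∧ ∑ i, c i • x i = y := by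
  set c : ι → ℝ := fun i => if h : i ∈ I then B.coord ⟨i, h⟩ y else 0 with hc
  have hout : ∀ i ∉ I, c i = 0 := fun i hi => by simp [hc, hi]
  have hin : ∀ j : I, c j = B.coord j y := fun j => by simp [hc]
  refine ⟨c, hout, hin, ?_, ?_⟩
  · rw [← Finset.sum_subset (Finset.subset_univ I) fun i _ hi => hout i hi,
      ← Finset.sum_coe_sort I]
    simp only [hin, B.sum_coord_apply_eq_one]
  · rw [← Finset.sum_subset (Finset.subset_univ I) fun i _ hi => by rw [hout i hi, zero_smul],
      ← Finset.sum_coe_sort I]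
    simp only [hin, ← hB, B.linear_combination_coord_eq_self]

/-- A positive vector stays nonnegative after a small enough perturbation. -/
theorem Finset.exists_pos_forall_mul_le {ι : Type*} (s : Finset ι) {c : ι → ℝ}
    (hc : ∀ j ∈ s, 0 < c j) (b : ι → ℝ) : ∃ ε > 0, ∀ j ∈ s, ε * b j ≤ c j := by
  have hev : ∀ᶠ ε in nhdsWithin (0 : ℝ) (Set.Ioi 0), ∀ j ∈ s, ε * b j ≤ c j := by
    refine (Finset.eventually_all s).2 fun j hj => nhdsWithin_le_nhds ?_
    have hcont : ContinuousAt (fun ε : ℝ => ε * b j) 0 := by fun_prop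
    exact (hcont.eventually_lt_const (by simpa using hc j hj)).mono fun _ h => h.le
  obtain ⟨ε, hε, hpos⟩ := (hev.and self_mem_nhdsWithin).exists
  exact ⟨ε, hpos, hε⟩

/-- Euclidean quadratic case: if `I` indexes `d+1` affinely independent points
of the grid `Γ = {x_1,…,x_k} ⊂ ℝ^d` (of affine dimension `d`) whose optimality region `D_I(Γ)`
has nonempty interior, then the simplex defined by `{x_j : j ∈ I}` has the Delaunay property:
its circumscribed sphere contains no point of `Γ` in its interior. -/
theorem stmt13 (d k : ℕ) (x : Fin k → EuclideanSpace ℝ (Fin d))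
    (hspan : affineSpan ℝ (Set.range x) = ⊤)
    (I : Finset (Fin k)) (hcard : I.card = d + 1)
    (hindep : AffineIndependent ℝ (fun j : I => x j))
    (hne : (interior (dualQuantD 2 x I)).Nonempty) :
    ∃ (z : EuclideanSpace ℝ (Fin d)) (r : ℝ),
      (∀ j ∈ I, dist z (x j) = r) ∧ ∀ i, r ≤ dist z (x i) := by
  classical
  have htop : affineSpan ℝ (Set.range fun j : I => x j) = ⊤ := by
    rw [hindep.affineSpan_eq_top_iff_card_eq_finrank_add_one]
    simp [hcard]
  let B : AffineBasis I ℝ (EuclideanSpace ℝ (Fin d)) := ⟨fun j : I => x j, hindep, htop⟩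
  have hB : ∀ j, B j = x j := fun _ => rfl
  have hI : I.Nonempty := Finset.card_pos.1 (by omega)
  have : Nonempty I := hI.to_subtype
  obtain ⟨S, ⟨-, hS⟩, -⟩ := hindep.existsUnique_dist_eq
  have hr : ∀ j ∈ I, dist S.center (x j) = S.radius := fun j hj => by
    rw [dist_comm]
    exact hS ⟨⟨j, hj⟩, rfl⟩
  refine ⟨S.center, S.radius, hr, fun i => ?_⟩
  by_contra! hlt
  have hsupp {v : Fin k → ℝ} (hv : ∀ m ∉ I, v m = 0) (hv1 : ∑ m, v m = 1) :
      ∑ m, v m * ‖S.center - x m‖ ^ 2 = S.radius ^ 2 := by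
    have hterm (m : Fin k) : v m * ‖S.center - x m‖ ^ 2 = v m * S.radius ^ 2 := by
      by_cases hm : m ∈ I
      · rw [← dist_eq_norm, hr m hm]
      · simp [hv m hm]
    simp only [hterm, ← Finset.sum_mul, hv1, one_mul]
  obtain ⟨ξ, hξ⟩ := hne
  obtain ⟨w, hw0, hwI, hw1, hwx, hwF⟩ := interior_subset hξ
  have hsub : dualQuantD 2 x I ⊆ convexHull ℝ (Set.range B) := by
    rintro y ⟨v, hv0, hvI, hv1, rfl, -⟩
    rw [← Finset.sum_subset (Finset.subset_univ I) fun m _ hm => by rw [hvI m hm, zero_smul]]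
    refine (convex_convexHull ℝ _).sum_mem (fun m _ => hv0 m) ?_
      fun m hm => subset_convexHull ℝ _ ⟨⟨m, hm⟩, rfl⟩
    rw [Finset.sum_subset (Finset.subset_univ I) fun m _ hm => hvI m hm, hv1]
  have hpos : ∀ j, 0 < B.coord j ξ := by
    have := interior_mono hsub hξ
    rwa [B.interior_convexHull] at this
  obtain ⟨c, hcI, hcB, hc1, hcx⟩ := B.exists_coord_extend hB ξ
  obtain ⟨b, hbI, -, hb1, hbx⟩ := B.exists_coord_extend hB (x i)
  obtain ⟨ε, hε, hεb⟩ := I.exists_pos_forall_mul_le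
    (fun j hj => (hcB ⟨j, hj⟩).symm ▸ hpos ⟨j, hj⟩) b
  set l : Fin k → ℝ := fun m => c m - ε * b m + ε * (Pi.single i 1 : Fin k → ℝ) m with hl
  have hl0 (m : Fin k) : 0 ≤ l m := by
    have hsingle : 0 ≤ ε * (Pi.single i 1 : Fin k → ℝ) m := by
      rw [Pi.single_apply]
      positivity
    by_cases hm : m ∈ I
    · linarith [hεb m hm]
    · simpa [hl, hcI m hm, hbI m hm] using hsingle
  have hl1 : ∑ m, l m = 1 := by
    simp [hl, Finset.sum_add_distrib, Finset.sum_sub_distrib, ← Finset.mul_sum, hc1, hb1]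
  have hlx : ∑ m, l m • x m = ξ := by
    have hsingle : ∑ m, (Pi.single i 1 : Fin k → ℝ) m • x m = x i := by
      simp [Pi.single_apply, ite_smul]
    simp only [hl, add_smul, sub_smul, mul_smul, Finset.sum_add_distrib, Finset.sum_sub_distrib,
      ← Finset.smul_sum, hcx, hbx, hsingle, sub_add_cancel]
  have hlsum : ∑ m, l m * ‖S.center - x m‖ ^ 2 =
      S.radius ^ 2 - ε * S.radius ^ 2 + ε * dist S.center (x i) ^ 2 := by
    have hsingle : ∑ m, (Pi.single i 1 : Fin k → ℝ) m * ‖S.center - x m‖ ^ 2 =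
        dist S.center (x i) ^ 2 := by
      simp [Pi.single_apply, dist_eq_norm]
    simp only [hl, add_mul, sub_mul, mul_assoc, Finset.sum_add_distrib, Finset.sum_sub_distrib,
      ← Finset.mul_sum, hsupp hcI hc1, hsupp hbI hb1, hsingle]
  have hle : dualQuantFp 2 x ξ ≤ ENNReal.ofReal (∑ m, l m * ‖ξ - x m‖ ^ (2 : ℝ)) :=
    iInf_le _ (⟨l, hl0, hl1, hlx⟩ :
      {l : Fin k → ℝ // (∀ i, 0 ≤ l i) ∧ ∑ i, l i = 1 ∧ ∑ i, l i • x i = ξ})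
  rw [← hwF, ENNReal.ofReal_le_ofReal_iff
    (Finset.sum_nonneg fun m _ => mul_nonneg (hl0 m) (by positivity))] at hle
  simp only [Real.rpow_two] at hle
  rw [sum_mul_sq_norm_sub_barycenter _ hw1 hwx S.center, hsupp hwI hw1,
    sum_mul_sq_norm_sub_barycenter _ hl1 hlx S.center, hlsum] at hle
  have hsq : dist S.center (x i) ^ 2 < S.radius ^ 2 := pow_lt_pow_left₀ hlt dist_nonneg two_ne_zero
  linarith [mul_lt_mul_of_pos_left hsq hε]
end
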